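/- arXiv:2309.15338 — 3 statements merged into one kernel-verified Lean document; each statement's English description precedes it below -/
import Mathlib

section
/- For every ε > 0 there exist a positive integer d_ε and a function f : ℕ → ℝ with 0 < f(d) ≤ 1/2 for all d, such that for all integers d ≥ d_ε, all integers N ≥ 1, and every point a ∈ W with dist_d(a, c) ≥ f(d), the proportion of vertices v ∈ V for which the angle θ_c(v) at c in the triangle (a, c, v) satisfies |cos θ_c(v)| ≤ ε is at least 1 − ε. -/
/-- Euclidean distance between two points of `ℝ^d`. -/
noncomputable def dE {d : ℕ} (x y : Fin d → ℝ) : ℝ :=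
  Real.sqrt (∑ i, (x i - y i) ^ 2)

/-- Normalized distance `dist(x,y)/(√d · N)`. -/
noncomputable def dn (d N : ℕ) (x y : Fin d → ℝ) : ℝ :=
  dE x y / (Real.sqrt d * N)

/-- The lattice points `{0,1,…,N}^d` of the hypercube `[0,N]^d`. -/
noncomputable def cubeW (d N : ℕ) : Finset (Fin d → ℝ) :=
  Finset.image (fun f : Fin d → Fin (N + 1) => fun i => (f i : ℝ)) Finset.univ

/-- The `2^d` vertices `{0,N}^d` of the hypercube `[0,N]^d`. -/
noncomputable def cubeV (d N : ℕ) : Finset (Fin d → ℝ) :=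
  Finset.image (fun f : Fin d → Bool => fun i => if f i then (N : ℝ) else 0) Finset.univ

/-- The center `(N/2, …, N/2)` of the hypercube `[0,N]^d`. -/
noncomputable def ctr (d N : ℕ) : Fin d → ℝ := fun _ => (N : ℝ) / 2

/-- Average of squared Euclidean distances from `a` to the vertices. -/
noncomputable def A_V (d N : ℕ) (a : Fin d → ℝ) : ℝ :=
  (∑ v ∈ cubeV d N, dE v a ^ 2) / 2 ^ d

/-- Normalized average of squared distances from `a` to the vertices. -/
noncomputable def B_V (d N : ℕ) (a : Fin d → ℝ) : ℝ :=
  A_V d N a / (d * (N : ℝ) ^ 2)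

/-- Average of squared Euclidean distances from `a` to the lattice points. -/
noncomputable def A_W (d N : ℕ) (a : Fin d → ℝ) : ℝ :=
  (∑ w ∈ cubeW d N, dE w a ^ 2) / ((N : ℝ) + 1) ^ d

/-- Normalized average of squared distances from `a` to the lattice points. -/
noncomputable def B_W (d N : ℕ) (a : Fin d → ℝ) : ℝ :=
  A_W d N a / (d * (N : ℝ) ^ 2)

open Classical in
/-- Number of elements of a finite set satisfying a predicate. -/
noncomputable def pcount {α : Type*} (s : Finset α) (p : α → Prop) : ℕ :=
  (s.filter p).card

open Classical in
/-- Ordered pairs of vertices forming a non-degenerate triangle with `a`. -/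
noncomputable def TaV (d N : ℕ) (a : Fin d → ℝ) : Finset ((Fin d → ℝ) × (Fin d → ℝ)) :=
  ((cubeV d N) ×ˢ (cubeV d N)).filter (fun p => a ≠ p.1 ∧ a ≠ p.2 ∧ p.1 ≠ p.2)

open Classical in
/-- Ordered pairs of lattice points forming a non-degenerate triangle with `a`. -/
noncomputable def TaW (d N : ℕ) (a : Fin d → ℝ) : Finset ((Fin d → ℝ) × (Fin d → ℝ)) :=
  ((cubeW d N) ×ˢ (cubeW d N)).filter (fun p => a ≠ p.1 ∧ a ≠ p.2 ∧ p.1 ≠ p.2)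

/-- Cosine of the angle at `c` in the triangle `(a, c, v)`. -/
noncomputable def cosAngleAt {d : ℕ} (c a v : Fin d → ℝ) : ℝ :=
  (∑ i, (a i - c i) * (v i - c i)) / (dE a c * dE v c)

/-- Second moment of a Rademacher sum. -/
theorem sum_sq_sum_sign (d : ℕ) (b : Fin d → ℝ) :
    ∑ f : Fin d → Bool, (∑ i, b i * (if f i then 1 else -1)) ^ 2 = 2 ^ d * ∑ i, b i ^ 2 := by
  induction d with
  | zero => simp
  | succ d ih =>
    rw [← (Fin.consEquiv fun _ => Bool).sum_comp, Fintype.sum_prod_type]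
    simp only [Fintype.sum_bool, Fin.consEquiv_apply, Fin.sum_univ_succ, Fin.cons_zero,
      Fin.cons_succ]
    rw [← Finset.sum_add_distrib, pow_succ, mul_add, mul_right_comm _ 2 (∑ i : Fin d, _),
      ← ih fun i => b i.succ]
    have hcard : (2 : ℝ) ^ d * 2 * b 0 ^ 2 = ∑ _f : Fin d → Bool, 2 * b 0 ^ 2 := by
      simp [mul_assoc]
    rw [hcard, Finset.sum_mul, ← Finset.sum_add_distrib]
    refine Finset.sum_congr rfl fun f _ => ?_
    simp only [if_true, Bool.false_eq_true, if_false]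
    ring

theorem cubeV_param_injective (d N : ℕ) (hN : 1 ≤ N) :
    Function.Injective (fun (f : Fin d → Bool) (i : Fin d) => if f i then (N : ℝ) else 0) := by
  intro f g h
  have hN' : (N : ℝ) ≠ 0 := by positivity
  funext i
  have hi := congrFun h i
  cases hf : f i <;> cases hg : g i <;> simp_all [eq_comm (a := (0 : ℝ))]

theorem card_cubeV (d N : ℕ) (hN : 1 ≤ N) : (cubeV d N).card = 2 ^ d := by
  rw [cubeV, Finset.card_image_of_injective _ (cubeV_param_injective d N hN)]
  simp

theorem sum_sq_cosAngleAt_le (d N : ℕ) (hN : 1 ≤ N) (a : Fin d → ℝ) :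
    ∑ v ∈ cubeV d N, cosAngleAt (ctr d N) a v ^ 2 ≤ 2 ^ d / d := by
  rw [cubeV, Finset.sum_image (cubeV_param_injective d N hN).injOn]
  set A : ℝ := ∑ i, (a i - ctr d N i) ^ 2 with hA
  have hA0 : 0 ≤ A := Finset.sum_nonneg fun i _ => sq_nonneg _
  have hcos : ∀ f : Fin d → Bool,
      cosAngleAt (ctr d N) a (fun i => if f i then (N : ℝ) else 0) ^ 2 =
        (∑ i, ((a i - ctr d N i) * (N / 2)) * (if f i then 1 else -1)) ^ 2 /
          (A * (d * (N / 2) ^ 2)) := by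
    intro f
    have hsign : ∀ i, (if f i then (N : ℝ) else 0) - ctr d N i =
        N / 2 * (if f i then 1 else -1) := by
      intro i
      unfold ctr
      split_ifs <;> ring
    unfold cosAngleAt dE
    rw [div_pow, mul_pow, Real.sq_sqrt hA0, Real.sq_sqrt
      (Finset.sum_nonneg fun i _ => sq_nonneg _)]
    simp only [hsign, mul_assoc]
    simp
  simp only [hcos]
  rw [← Finset.sum_div, sum_sq_sum_sign]
  simp only [mul_pow]
  rw [← Finset.sum_mul, ← hA]
  have hN' : (0 : ℝ) < N := by positivity
  rcases hA0.eq_or_lt with h | h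
  · rw [← h]
    simp only [zero_mul, mul_zero, div_zero]
    positivity
  · rcases Nat.eq_zero_or_pos d with rfl | hd
    · simp
    · apply le_of_eq
      field_simp

theorem stmt1 :
    ∀ ε : ℝ, 0 < ε → ∃ (dε : ℕ) (f : ℕ → ℝ), 0 < dε ∧ (∀ d, 0 < f d ∧ f d ≤ 1 / 2) ∧
      ∀ d N : ℕ, dε ≤ d → 1 ≤ N → ∀ a ∈ cubeW d N, f d ≤ dn d N a (ctr d N) →
        (1 : ℝ) - ε ≤
          (pcount (cubeV d N) (fun v => |cosAngleAt (ctr d N) a v| ≤ ε) : ℝ) /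
            (cubeV d N).card := by
  intro ε hε
  refine ⟨⌈1 / ε ^ 3⌉₊ + 1, fun _ => 1 / 2, Nat.succ_pos _, fun _ => by norm_num, ?_⟩
  intro d N hd hN a _ _
  classical
  have hd0 : (0 : ℝ) < d := by
    have : 0 < d := by omega
    exact_mod_cast this
  have hdε : 1 / ε ^ 3 ≤ d :=
    (Nat.le_ceil _).trans (by exact_mod_cast (Nat.le_succ _).trans hd)
  set good : (Fin d → ℝ) → Prop := fun v => |cosAngleAt (ctr d N) a v| ≤ ε with hgood
  set bad := (cubeV d N).filter fun v => ¬ good v with hbad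
  have hsplit : (pcount (cubeV d N) good : ℝ) + bad.card = 2 ^ d := by
    have h := Finset.card_filter_add_card_filter_not (s := cubeV d N) good
    rw [card_cubeV d N hN] at h
    have hp : pcount (cubeV d N) good = ((cubeV d N).filter good).card := by
      unfold pcount
      congr
    rw [hp]
    exact_mod_cast h
  have hcheb : (bad.card : ℝ) * ε ^ 2 ≤ 2 ^ d / d := by
    calc (bad.card : ℝ) * ε ^ 2 = ∑ _v ∈ bad, ε ^ 2 := by simp
      _ ≤ ∑ v ∈ bad, cosAngleAt (ctr d N) a v ^ 2 := by
        refine Finset.sum_le_sum fun v hv => ?_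
        have hlt : ε < |cosAngleAt (ctr d N) a v| := not_le.mp (Finset.mem_filter.mp hv).2
        rw [← sq_abs (cosAngleAt _ _ _)]
        gcongr
      _ ≤ ∑ v ∈ cubeV d N, cosAngleAt (ctr d N) a v ^ 2 :=
        Finset.sum_le_sum_of_subset_of_nonneg (Finset.filter_subset _ _)
          fun v _ _ => sq_nonneg _
      _ ≤ 2 ^ d / d := sum_sq_cosAngleAt_le d N hN a
  have hbound : (bad.card : ℝ) ≤ ε * 2 ^ d := by
    have hε3 : 1 ≤ d * ε ^ 3 := by rwa [div_le_iff₀ (by positivity)] at hdε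
    have h1 : (2 : ℝ) ^ d / d ≤ ε * 2 ^ d * ε ^ 2 := by
      rw [div_le_iff₀ hd0]
      calc (2 : ℝ) ^ d ≤ 2 ^ d * (d * ε ^ 3) := le_mul_of_one_le_right (by positivity) hε3
        _ = ε * 2 ^ d * ε ^ 2 * d := by ring
    exact le_of_mul_le_mul_right (hcheb.trans h1) (by positivity)
  rw [card_cubeV d N hN, le_div_iff₀ (by positivity)]
  push_cast
  linarith
end

section
/- For every ε > 0 there exist positive integers d_ε and N_ε such that for all integers d ≥ d_ε, N ≥ N_ε, and every point a ∈ W, the proportion of ordered pairs (w₁, w₂) ∈ W × W satisfying both |dist_d(w₁, w₂) − 1/√6| ≤ ε and |dist_d(a, w_j) − √(1/12 + r_a²)| ≤ ε for j = 1, 2, is at least 1 − ε, where r_a = dist_d(a, c). -/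
/-- Second moment bound for a sum of independent centered coordinate functions. -/
theorem sum_sq_sum_le {T : Type*} [Fintype T] {d : ℕ} (g : Fin d → T → ℝ)
    (hb : ∀ i t, |g i t| ≤ 1) (h0 : ∀ i, ∑ t, g i t = 0) :
    ∑ f : Fin d → T, (∑ i, g i (f i)) ^ 2 ≤ d * (Fintype.card T : ℝ) ^ d := by
  induction d with
  | zero => simp
  | succ d ih =>
    have ih' := ih (fun i => g i.succ) (fun i t => hb _ t) (fun i => h0 _)
    rw [← (Fin.consEquiv (fun _ : Fin (d + 1) => T)).sum_comp, Fintype.sum_prod_type_right]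
    have key : ∀ f : Fin d → T,
        ∑ t, (∑ i, g i (Fin.consEquiv (fun _ : Fin (d + 1) => T) (t, f) i)) ^ 2
          ≤ Fintype.card T + Fintype.card T * (∑ i, g (Fin.succ i) (f i)) ^ 2 := by
      intro f
      have hexp : ∀ t, (∑ i, g i (Fin.consEquiv (fun _ : Fin (d + 1) => T) (t, f) i)) ^ 2
          = g 0 t ^ 2 + g 0 t * (2 * ∑ i, g (Fin.succ i) (f i))
            + (∑ i, g (Fin.succ i) (f i)) ^ 2 := by
        intro t
        simp only [Fin.consEquiv_apply, Fin.sum_univ_succ, Fin.cons_zero, Fin.cons_succ]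
        ring
      simp only [hexp, Finset.sum_add_distrib, ← Finset.sum_mul, h0]
      have hsq : ∑ t, g 0 t ^ 2 ≤ ∑ _t : T, (1 : ℝ) :=
        Finset.sum_le_sum fun t _ => (sq_le_one_iff_abs_le_one _).2 (hb 0 t)
      simp only [Finset.sum_const, Finset.card_univ, nsmul_eq_mul, mul_one] at hsq ⊢
      linarith
    refine (Finset.sum_le_sum fun f _ => key f).trans ?_
    rw [Finset.sum_add_distrib, ← Finset.mul_sum]
    have hn : (0 : ℝ) ≤ Fintype.card T := Nat.cast_nonneg _
    have := mul_le_mul_of_nonneg_left ih' hn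
    simp only [Finset.sum_const, Finset.card_univ, nsmul_eq_mul, Fintype.card_fun,
      Fintype.card_fin]
    push_cast
    rw [pow_succ]
    linarith

/-- Chebyshev's inequality for a sum of independent `[0,1]`-valued coordinate functions:
the sum is close to its mean outside a small exceptional set. -/
theorem exists_exceptional_finset {T : Type*} [Fintype T] [Nonempty T] {d : ℕ} (hd : 0 < d)
    (h : Fin d → T → ℝ) (hnn : ∀ i t, 0 ≤ h i t) (hle : ∀ i t, h i t ≤ 1) {δ : ℝ} (hδ : 0 < δ) :
    ∃ B : Finset (Fin d → T), (B.card : ℝ) ≤ (Fintype.card T : ℝ) ^ d / (d * δ ^ 2) ∧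
      ∀ f ∉ B, |∑ i, h i (f i) - ∑ i, (∑ t, h i t) / Fintype.card T| ≤ d * δ := by
  have hn : (0 : ℝ) < Fintype.card T := Nat.cast_pos.2 Fintype.card_pos
  have hd' : (0 : ℝ) < d := Nat.cast_pos.2 hd
  have hsum := sum_sq_sum_le (fun i t => h i t - (∑ t, h i t) / Fintype.card T)
    (by
      intro i t
      have h1 : 0 ≤ (∑ t, h i t) / Fintype.card T :=
        div_nonneg (Finset.sum_nonneg fun t _ => hnn i t) hn.le
      have h2 : (∑ t, h i t) / Fintype.card T ≤ 1 := by
        rw [div_le_one hn]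
        simpa using Finset.sum_le_sum fun t (_ : t ∈ Finset.univ) => hle i t
      rw [abs_le]
      constructor <;> linarith [hnn i t, hle i t])
    (by
      intro i
      rw [Finset.sum_sub_distrib]
      simp only [Finset.sum_const, Finset.card_univ, nsmul_eq_mul]
      field_simp
      ring)
  simp only [Finset.sum_sub_distrib] at hsum
  classical
  set B := Finset.univ.filter fun f : Fin d → T =>
    d * δ < |∑ i, h i (f i) - ∑ i, (∑ t, h i t) / Fintype.card T| with hB
  have hlow : (B.card : ℝ) * (d * δ) ^ 2 ≤ d * (Fintype.card T : ℝ) ^ d := by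
    refine le_trans ?_ hsum
    rw [← nsmul_eq_mul]
    refine (Finset.card_nsmul_le_sum B _ _ fun f hf => ?_).trans
      (Finset.sum_le_sum_of_subset_of_nonneg (Finset.subset_univ B) fun f _ _ => sq_nonneg _)
    have hf' := (Finset.mem_filter.1 hf).2
    rw [← sq_abs (∑ i, h i (f i) - _)]
    exact pow_le_pow_left₀ (by positivity) hf'.le 2
  refine ⟨B, ?_, fun f hf => ?_⟩
  · rw [le_div_iff₀ (by positivity)]
    refine le_of_mul_le_mul_left ?_ hd'
    linarith
  · simpa [hB] using hf

theorem abs_sqrt_sub_sqrt_le {x y ε : ℝ} (hx : 0 ≤ x) (hy : 0 ≤ y) (hε : 0 ≤ ε)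
    (h : |x - y| ≤ ε ^ 2) : |√x - √y| ≤ ε := by
  refine abs_le_of_sq_le_sq ?_ hε
  obtain ⟨h1, h2⟩ := abs_le.1 h
  have hx' := Real.sq_sqrt hx
  have hy' := Real.sq_sqrt hy
  have := Real.sqrt_nonneg x
  have := Real.sqrt_nonneg y
  rcases le_total (√x) (√y) with hxy | hxy
  · nlinarith
  · nlinarith

theorem dn_eq_sqrt {d N : ℕ} (x y : Fin d → ℝ) :
    dn d N x y = √((∑ i, ((x i - y i) / N) ^ 2) / d) := by
  have hN : (0 : ℝ) ≤ N := Nat.cast_nonneg N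
  simp only [div_pow, ← Finset.sum_div]
  rw [dn, dE, div_div, Real.sqrt_div (Finset.sum_nonneg fun i _ => sq_nonneg _),
    Real.sqrt_mul (sq_nonneg _), Real.sqrt_sq hN, mul_comm]

theorem dn_sub_sqrt_le {d N : ℕ} (hd : 0 < d) {x y : Fin d → ℝ} {M τ δ ε : ℝ}
    (hτ : 0 ≤ τ) (hε : 0 ≤ ε) (hδε : 2 * δ ≤ ε ^ 2)
    (hdev : |∑ i, ((x i - y i) / N) ^ 2 - M| ≤ d * δ) (hM : |M - d * τ| ≤ d * δ) :
    |dn d N x y - √τ| ≤ ε := by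
  have hd' : (0 : ℝ) < d := Nat.cast_pos.2 hd
  rw [dn_eq_sqrt]
  refine abs_sqrt_sub_sqrt_le
    (div_nonneg (Finset.sum_nonneg fun i _ => sq_nonneg _) hd'.le) hτ hε ?_
  rw [div_sub' hd'.ne', abs_div, abs_of_pos hd', div_le_iff₀ hd']
  have := abs_sub_le (∑ i, ((x i - y i) / (N : ℝ)) ^ 2) M (d * τ)
  nlinarith

theorem sum_fin_cast (N : ℕ) : ∑ s : Fin (N + 1), (s : ℝ) = N * (N + 1) / 2 := by
  rw [Fin.sum_univ_eq_sum_range (fun k => (k : ℝ))]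
  induction N with
  | zero => simp
  | succ n ih =>
    rw [Finset.sum_range_succ, ih]
    push_cast
    ring

theorem sum_fin_cast_sq (N : ℕ) :
    ∑ s : Fin (N + 1), (s : ℝ) ^ 2 = N * (N + 1) * (2 * N + 1) / 6 := by
  rw [Fin.sum_univ_eq_sum_range (fun k => (k : ℝ) ^ 2)]
  induction N with
  | zero => simp
  | succ n ih =>
    rw [Finset.sum_range_succ, ih]
    push_cast
    ring

theorem sum_fin_sub_sq (N : ℕ) (x : ℝ) :
    ∑ s : Fin (N + 1), (x - s) ^ 2
      = (N + 1) * (x ^ 2 - N * x + N * (2 * N + 1) / 6) := by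
  have hexp : ∀ s : Fin (N + 1), (x - s) ^ 2 = x ^ 2 - 2 * x * (s : ℝ) + (s : ℝ) ^ 2 :=
    fun s => by ring
  simp only [hexp, Finset.sum_add_distrib, Finset.sum_sub_distrib, ← Finset.mul_sum,
    sum_fin_cast, sum_fin_cast_sq, Finset.sum_const, Finset.card_univ, Fintype.card_fin,
    nsmul_eq_mul]
  push_cast
  ring

theorem avg_sub_sq_fst {N : ℕ} (hN : 0 < N) (x : ℝ) :
    (∑ t : Fin (N + 1) × Fin (N + 1), ((x - (t.1 : ℝ)) / N) ^ 2)
        / Fintype.card (Fin (N + 1) × Fin (N + 1))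
      = 1 / 12 + ((x - N / 2) / N) ^ 2 + 1 / (6 * N) := by
  have hN' : (N : ℝ) ≠ 0 := Nat.cast_ne_zero.2 hN.ne'
  have hN1 : (N : ℝ) + 1 ≠ 0 := by positivity
  simp only [div_pow, ← Finset.sum_div, Fintype.sum_prod_type_right, sum_fin_sub_sq,
    Finset.sum_const, Finset.card_univ, Fintype.card_prod, Fintype.card_fin, nsmul_eq_mul]
  push_cast
  field_simp
  ring

theorem avg_sub_sq_snd {N : ℕ} (hN : 0 < N) (x : ℝ) :
    (∑ t : Fin (N + 1) × Fin (N + 1), ((x - (t.2 : ℝ)) / N) ^ 2)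
        / Fintype.card (Fin (N + 1) × Fin (N + 1))
      = 1 / 12 + ((x - N / 2) / N) ^ 2 + 1 / (6 * N) := by
  rw [← avg_sub_sq_fst hN x, ← (Equiv.prodComm _ _).sum_comp]
  rfl

theorem avg_fst_sub_snd_sq {N : ℕ} (hN : 0 < N) :
    (∑ t : Fin (N + 1) × Fin (N + 1), (((t.1 : ℝ) - (t.2 : ℝ)) / N) ^ 2)
        / Fintype.card (Fin (N + 1) × Fin (N + 1))
      = 1 / 6 + 1 / (3 * N) := by
  have hN' : (N : ℝ) ≠ 0 := Nat.cast_ne_zero.2 hN.ne'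
  have hN1 : (N : ℝ) + 1 ≠ 0 := by positivity
  simp only [div_pow, ← Finset.sum_div, Fintype.sum_prod_type, sum_fin_sub_sq,
    ← Finset.mul_sum, Finset.sum_add_distrib, Finset.sum_sub_distrib,
    sum_fin_cast, sum_fin_cast_sq,
    Finset.sum_const, Finset.card_univ, Fintype.card_prod, Fintype.card_fin, nsmul_eq_mul]
  push_cast
  field_simp
  ring

theorem sq_div_le_one {N x y : ℝ} (hx : 0 ≤ x) (hxN : x ≤ N) (hy : 0 ≤ y) (hyN : y ≤ N) :
    ((x - y) / N) ^ 2 ≤ 1 := by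
  rw [sq_le_one_iff_abs_le_one, abs_div, abs_of_nonneg (hx.trans hxN)]
  exact div_le_one_of_le₀ (abs_le.2 ⟨by linarith, by linarith⟩) (hx.trans hxN)

/-- Pairs of lattice points, encoded coordinatewise. -/
noncomputable def pairPoint (d N : ℕ) (f : Fin d → Fin (N + 1) × Fin (N + 1)) :
    (Fin d → ℝ) × (Fin d → ℝ) :=
  (fun i => ((f i).1 : ℝ), fun i => ((f i).2 : ℝ))

theorem pairPoint_injective (d N : ℕ) : Function.Injective (pairPoint d N) := by
  intro f g hfg
  obtain ⟨h1, h2⟩ := Prod.ext_iff.1 hfg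
  funext i
  have h1i : ((f i).1 : ℝ) = ((g i).1 : ℝ) := congrFun h1 i
  have h2i : ((f i).2 : ℝ) = ((g i).2 : ℝ) := congrFun h2 i
  exact Prod.ext (Fin.ext (Nat.cast_injective h1i)) (Fin.ext (Nat.cast_injective h2i))

open Classical in
theorem cubeW_product_eq_image (d N : ℕ) :
    cubeW d N ×ˢ cubeW d N = Finset.univ.image (pairPoint d N) := by
  ext ⟨x, y⟩
  simp only [cubeW, Finset.mem_product, Finset.mem_image, Finset.mem_univ, true_and]
  constructor
  · rintro ⟨⟨f, rfl⟩, g, rfl⟩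
    exact ⟨fun i => (f i, g i), rfl⟩
  · rintro ⟨f, hf⟩
    obtain ⟨rfl, rfl⟩ := Prod.ext_iff.1 hf
    exact ⟨⟨fun i => (f i).1, rfl⟩, fun i => (f i).2, rfl⟩

theorem card_cubeW_product (d N : ℕ) :
    (cubeW d N ×ˢ cubeW d N).card = Fintype.card (Fin (N + 1) × Fin (N + 1)) ^ d := by
  classical
  rw [cubeW_product_eq_image, Finset.card_image_of_injective _ (pairPoint_injective d N),
    Finset.card_univ, Fintype.card_fun, Fintype.card_fin]

theorem card_le_pcount_add_card {d N : ℕ} {p : (Fin d → ℝ) × (Fin d → ℝ) → Prop}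
    (B : Finset (Fin d → Fin (N + 1) × Fin (N + 1))) (hB : ∀ f ∉ B, p (pairPoint d N f)) :
    Fintype.card (Fin (N + 1) × Fin (N + 1)) ^ d
      ≤ pcount (cubeW d N ×ˢ cubeW d N) p + B.card := by
  classical
  rw [pcount, cubeW_product_eq_image, Finset.filter_image,
    Finset.card_image_of_injective _ (pairPoint_injective d N)]
  calc Fintype.card (Fin (N + 1) × Fin (N + 1)) ^ d
      = (Finset.univ : Finset (Fin d → Fin (N + 1) × Fin (N + 1))).card := by
        rw [Finset.card_univ, Fintype.card_fun, Fintype.card_fin]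
    _ ≤ ((Finset.univ.filter fun f => p (pairPoint d N f)) ∪ B).card := by
        refine Finset.card_le_card fun f _ => ?_
        by_cases hf : f ∈ B
        · exact Finset.mem_union_right _ hf
        · exact Finset.mem_union_left _ (Finset.mem_filter.2 ⟨Finset.mem_univ _, hB f hf⟩)
    _ ≤ _ := Finset.card_union_le _ _

theorem mem_cubeW_bounds {d N : ℕ} {a : Fin d → ℝ} (ha : a ∈ cubeW d N) (i : Fin d) :
    0 ≤ a i ∧ a i ≤ N := by
  obtain ⟨f, -, rfl⟩ := Finset.mem_image.1 ha
  exact ⟨Nat.cast_nonneg _, Nat.cast_le.2 (Nat.lt_succ_iff.1 (f i).2)⟩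

theorem dn_sq {d N : ℕ} (x y : Fin d → ℝ) :
    dn d N x y ^ 2 = (∑ i, ((x i - y i) / N) ^ 2) / d := by
  rw [dn_eq_sqrt, Real.sq_sqrt (by positivity)]

theorem stmt2 :
    ∀ ε : ℝ, 0 < ε → ∃ dε Nε : ℕ, 0 < dε ∧ 0 < Nε ∧
      ∀ d N : ℕ, dε ≤ d → Nε ≤ N → ∀ a ∈ cubeW d N,
        (1 : ℝ) - ε ≤
          (pcount ((cubeW d N) ×ˢ (cubeW d N))
              (fun p =>
                |dn d N p.1 p.2 - 1 / Real.sqrt 6| ≤ ε ∧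
                |dn d N a p.1 - Real.sqrt (1 / 12 + (dn d N a (ctr d N)) ^ 2)| ≤ ε ∧
                |dn d N a p.2 - Real.sqrt (1 / 12 + (dn d N a (ctr d N)) ^ 2)| ≤ ε) : ℝ) /
            ((cubeW d N) ×ˢ (cubeW d N)).card := by
  intro ε hε
  set δ : ℝ := ε ^ 2 / 2 with hδdef
  have hδ : 0 < δ := by positivity
  have hδε : 2 * δ ≤ ε ^ 2 := by rw [hδdef]; linarith
  refine ⟨⌈3 / (ε * δ ^ 2)⌉₊ + 1, ⌈1 / (3 * δ)⌉₊ + 1, by omega, by omega, ?_⟩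
  intro d N hd hN a ha
  have hd0 : 0 < d := by omega
  have hN0 : 0 < N := by omega
  have hd' : (0 : ℝ) < d := Nat.cast_pos.2 hd0
  have hN' : (0 : ℝ) < N := Nat.cast_pos.2 hN0
  have hdε : 3 / (d * δ ^ 2) ≤ ε := by
    have h1 : 3 / (ε * δ ^ 2) ≤ d := (Nat.le_ceil _).trans (Nat.cast_le.2 (by omega))
    rw [div_le_iff₀ (by positivity)] at h1 ⊢
    linarith
  have hNδ : 1 / (3 * (N : ℝ)) ≤ δ := by
    have h1 : 1 / (3 * δ) ≤ N := (Nat.le_ceil _).trans (Nat.cast_le.2 (by omega))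
    rw [div_le_iff₀ (by positivity)] at h1 ⊢
    linarith
  have hNδ' : 1 / (6 * (N : ℝ)) ≤ δ :=
    (one_div_le_one_div_of_le (by positivity) (by linarith)).trans hNδ
  have hcoord : ∀ s : Fin (N + 1), (0 : ℝ) ≤ (s : ℝ) ∧ (s : ℝ) ≤ N := fun s =>
    ⟨Nat.cast_nonneg _, Nat.cast_le.2 (Nat.lt_succ_iff.1 s.2)⟩
  have ha' := mem_cubeW_bounds ha
  obtain ⟨B₁, b₁, hB₁⟩ := exists_exceptional_finset (T := Fin (N + 1) × Fin (N + 1)) hd0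
    (fun _ t => (((t.1 : ℝ) - (t.2 : ℝ)) / N) ^ 2) (fun _ _ => sq_nonneg _)
    (fun _ t => sq_div_le_one (hcoord t.1).1 (hcoord t.1).2 (hcoord t.2).1 (hcoord t.2).2) hδ
  obtain ⟨B₂, b₂, hB₂⟩ := exists_exceptional_finset (T := Fin (N + 1) × Fin (N + 1)) hd0
    (fun i t => ((a i - (t.1 : ℝ)) / N) ^ 2) (fun _ _ => sq_nonneg _)
    (fun i t => sq_div_le_one (ha' i).1 (ha' i).2 (hcoord t.1).1 (hcoord t.1).2) hδ
  obtain ⟨B₃, b₃, hB₃⟩ := exists_exceptional_finset (T := Fin (N + 1) × Fin (N + 1)) hd0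
    (fun i t => ((a i - (t.2 : ℝ)) / N) ^ 2) (fun _ _ => sq_nonneg _)
    (fun i t => sq_div_le_one (ha' i).1 (ha' i).2 (hcoord t.2).1 (hcoord t.2).2) hδ
  simp only [avg_fst_sub_snd_sq hN0] at hB₁
  simp only [avg_sub_sq_fst hN0] at hB₂
  simp only [avg_sub_sq_snd hN0] at hB₃
  have hM₁ : |∑ _i : Fin d, (1 / 6 + 1 / (3 * (N : ℝ))) - d * (1 / 6)| ≤ d * δ := by
    have : ∑ _i : Fin d, (1 / 6 + 1 / (3 * (N : ℝ))) - d * (1 / 6) = d * (1 / (3 * (N : ℝ))) := by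
      simp only [Finset.sum_const, Finset.card_univ, Fintype.card_fin, nsmul_eq_mul]
      ring
    rw [this, abs_of_nonneg (by positivity)]
    exact mul_le_mul_of_nonneg_left hNδ hd'.le
  have hM₂ : |∑ i, (1 / 12 + ((a i - N / 2) / N) ^ 2 + 1 / (6 * (N : ℝ)))
      - d * (1 / 12 + dn d N a (ctr d N) ^ 2)| ≤ d * δ := by
    have : ∑ i, (1 / 12 + ((a i - N / 2) / N) ^ 2 + 1 / (6 * (N : ℝ)))
        - d * (1 / 12 + dn d N a (ctr d N) ^ 2) = d * (1 / (6 * (N : ℝ))) := by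
      rw [dn_sq, mul_add, mul_div_cancel₀ _ hd'.ne']
      simp only [Finset.sum_add_distrib, Finset.sum_const, Finset.card_univ, Fintype.card_fin,
        nsmul_eq_mul, ctr]
      ring
    rw [this, abs_of_nonneg (by positivity)]
    exact mul_le_mul_of_nonneg_left hNδ' hd'.le
  have hn : (0 : ℝ) < (Fintype.card (Fin (N + 1) × Fin (N + 1)) : ℝ) ^ d :=
    pow_pos (Nat.cast_pos.2 Fintype.card_pos) _
  rw [card_cubeW_product, Nat.cast_pow, le_div_iff₀ hn]
  have hunion : ((B₁ ∪ B₂ ∪ B₃).card : ℝ) ≤ B₁.card + B₂.card + B₃.card := by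
    have h₁ := Finset.card_union_le (B₁ ∪ B₂) B₃
    have h₂ := Finset.card_union_le B₁ B₂
    exact_mod_cast h₁.trans (by omega)
  have hbad := mul_le_mul_of_nonneg_right hdε hn.le
  rw [div_mul_eq_mul_div, mul_div_assoc] at hbad
  suffices h : (Fintype.card (Fin (N + 1) × Fin (N + 1)) : ℝ) ^ d ≤ _ + (B₁ ∪ B₂ ∪ B₃).card by
    rw [sub_mul, one_mul, sub_le_iff_le_add]
    exact h.trans (add_le_add_right (by linarith) _)
  rw [← Nat.cast_pow, ← Nat.cast_add, Nat.cast_le]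
  refine card_le_pcount_add_card _ fun f hf => ?_
  simp only [Finset.mem_union, not_or] at hf
  obtain ⟨⟨hf₁, hf₂⟩, hf₃⟩ := hf
  refine ⟨?_, ?_, ?_⟩
  · rw [← Real.sqrt_one, ← Real.sqrt_div zero_le_one]
    exact dn_sub_sqrt_le hd0 (by norm_num) hε.le hδε (hB₁ f hf₁) hM₁
  · exact dn_sub_sqrt_le hd0 (by positivity) hε.le hδε (hB₂ f hf₂) hM₂
  · exact dn_sub_sqrt_le hd0 (by positivity) hε.le hδε (hB₃ f hf₃) hM₂
end

section
/- Fix η ∈ (0, 1/2). For any integers d ≥ 2, N ≥ 1, and any point a ∈ W, the proportion of pairs (w₁, w₂) ∈ 𝒯_{a,W²} satisfying |dist_d(a, w₁) − dist_d(a, w₂)| ≤ 2/d^η is at least 1 − (102/15)·(1/d^{1−2η}). -/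
theorem Fin.sum_pi_sum_eq_zero {κ : Type*} [Fintype κ] (n : ℕ) (g : Fin n → κ → ℝ)
    (hg : ∀ i, ∑ k, g i k = 0) : ∑ f : Fin n → κ, ∑ i, g i (f i) = 0 := by
  induction n with
  | zero => simp
  | succ n ih =>
    rw [← (Fin.consEquiv fun _ => κ).sum_comp, Fintype.sum_prod_type]
    simp only [Fin.consEquiv_apply, Fin.sum_univ_succ, Fin.cons_zero, Fin.cons_succ,
      Finset.sum_add_distrib, Finset.sum_const]
    rw [ih (fun i => g i.succ) fun i => hg i.succ, ← Finset.smul_sum, hg 0]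
    simp

/-- The second moment of a sum of independent centred variables on a finite power. -/
theorem Fin.card_mul_sum_pi_sq {κ : Type*} [Fintype κ] (n : ℕ) (g : Fin n → κ → ℝ)
    (hg : ∀ i, ∑ k, g i k = 0) :
    (Fintype.card κ : ℝ) * ∑ f : Fin n → κ, (∑ i, g i (f i)) ^ 2 =
      (Fintype.card κ : ℝ) ^ n * ∑ i, ∑ k, g i k ^ 2 := by
  induction n with
  | zero => simp
  | succ n ih =>
    have h0 := Fin.sum_pi_sum_eq_zero n (fun i => g i.succ) fun i => hg i.succ
    have h1 := ih (fun i => g i.succ) fun i => hg i.succ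
    rw [← (Fin.consEquiv fun _ => κ).sum_comp, Fintype.sum_prod_type]
    simp only [Fin.consEquiv_apply, Fin.sum_univ_succ, Fin.cons_zero, Fin.cons_succ, add_sq,
      Finset.sum_add_distrib, Finset.sum_const, ← Finset.mul_sum]
    simp only [h0, mul_zero, Finset.sum_const_zero, nsmul_eq_mul, Finset.card_univ,
      Fintype.card_fun, Fintype.card_fin, Nat.cast_pow, ← Finset.mul_sum]
    linear_combination (Fintype.card κ : ℝ) * h1

theorem natCast_pi_injective (d N : ℕ) :
    Function.Injective (fun (f : Fin d → Fin (N + 1)) (i : Fin d) => ((f i : ℕ) : ℝ)) := by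
  intro f g h
  ext i
  have h' : ((f i : ℕ) : ℝ) = (g i : ℕ) := congrFun h i
  exact_mod_cast h'

theorem card_cubeW (d N : ℕ) : (cubeW d N).card = (N + 1) ^ d := by
  rw [cubeW, Finset.card_image_of_injective _ (natCast_pi_injective d N)]
  simp

theorem sum_cubeW (d N : ℕ) (F : (Fin d → ℝ) → ℝ) :
    ∑ w ∈ cubeW d N, F w = ∑ f : Fin d → Fin (N + 1), F (fun i => (f i : ℝ)) := by
  rw [cubeW, Finset.sum_image fun _ _ _ _ h => natCast_pi_injective d N h]

theorem mem_Icc_of_mem_cubeW {d N : ℕ} {a : Fin d → ℝ} (ha : a ∈ cubeW d N) (i : Fin d) :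
    a i ∈ Set.Icc (0 : ℝ) N := by
  obtain ⟨f, -, rfl⟩ := Finset.mem_image.1 ha
  exact ⟨by positivity, Nat.cast_le.2 (Nat.lt_succ_iff.1 (f i).2)⟩

/-- Euclidean distances from `a` to the lattice points have mean square deviation at most `N ^ 2`
from a suitable constant. -/
theorem exists_sum_dE_sub_sq_le {d N : ℕ} (hd : 1 ≤ d) (hN : 1 ≤ N) {a : Fin d → ℝ}
    (ha : a ∈ cubeW d N) :
    ∃ m : ℝ, ∑ w ∈ cubeW d N, (dE a w - m) ^ 2 ≤ ((N : ℝ) + 1) ^ d * (N : ℝ) ^ 2 := by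
  set X : Fin d → Fin (N + 1) → ℝ := fun i k => (a i - (k : ℕ)) ^ 2 with hX
  have hK : (0 : ℝ) < (N : ℝ) + 1 := by positivity
  set ν : Fin d → ℝ := fun i => (∑ k, X i k) / ((N : ℝ) + 1) with hν
  have hsum (i) : ∑ k, X i k = ((N : ℝ) + 1) * ν i := by simp only [hν]; field_simp
  have hcard : (Fintype.card (Fin (N + 1)) : ℝ) = (N : ℝ) + 1 := by simp
  have hX0 (i k) : 0 ≤ X i k := sq_nonneg _
  have hXN (i k) : X i k ≤ (N : ℝ) ^ 2 := by
    have h := mem_Icc_of_mem_cubeW ha i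
    have hk : ((k : ℕ) : ℝ) ≤ N := by exact_mod_cast Nat.lt_succ_iff.1 k.2
    have hk0 : (0 : ℝ) ≤ ((k : ℕ) : ℝ) := by positivity
    exact sq_le_sq' (by linarith [h.1]) (by linarith [h.2])
  have hν_pos (i) : 0 < ν i := by
    refine div_pos (Finset.sum_pos' (fun k _ => hX0 i k) ?_) hK
    by_cases h : a i = 0
    · exact ⟨Fin.last N, Finset.mem_univ _, by simp [hX, h]; positivity⟩
    · refine ⟨0, Finset.mem_univ _, ?_⟩
      simp only [hX, Fin.val_zero, Nat.cast_zero, sub_zero]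
      positivity
  have hν_sum : 0 < ∑ i, ν i :=
    Finset.sum_pos (fun i _ => hν_pos i) ⟨⟨0, hd⟩, Finset.mem_univ _⟩
  have hmoment := Fin.card_mul_sum_pi_sq d (fun i k => X i k - ν i) fun i => by
    simp [Finset.sum_sub_distrib, hsum]
  rw [hcard] at hmoment
  have hvar (i) : ∑ k, (X i k - ν i) ^ 2 ≤ (N : ℝ) ^ 2 * (((N : ℝ) + 1) * ν i) := by
    have h1 : ∑ k, (X i k - ν i) ^ 2 = ∑ k, X i k ^ 2 - ((N : ℝ) + 1) * ν i ^ 2 := by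
      simp only [sub_sq, Finset.sum_add_distrib, Finset.sum_sub_distrib, ← Finset.sum_mul,
        ← Finset.mul_sum, Finset.sum_const, nsmul_eq_mul, hsum, Finset.card_univ, hcard]
      ring
    have h2 : ∑ k, X i k ^ 2 ≤ ∑ k, (N : ℝ) ^ 2 * X i k :=
      Finset.sum_le_sum fun k _ => by nlinarith [hX0 i k, hXN i k]
    rw [← Finset.mul_sum, hsum] at h2
    have : 0 ≤ ((N : ℝ) + 1) * ν i ^ 2 := by positivity
    linarith
  have hS : ∑ f : Fin d → Fin (N + 1), (∑ i, (X i (f i) - ν i)) ^ 2 ≤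
      ((N : ℝ) + 1) ^ d * (N : ℝ) ^ 2 * ∑ i, ν i := by
    have h := Finset.sum_le_sum fun i (_ : i ∈ Finset.univ) => hvar i
    rw [← Finset.mul_sum, ← Finset.mul_sum] at h
    have h' := mul_le_mul_of_nonneg_left h (pow_nonneg hK.le d)
    rw [← hmoment] at h'
    refine le_of_mul_le_mul_left (h'.trans_eq ?_) hK
    ring
  refine ⟨√(∑ i, ν i), le_of_mul_le_mul_right (le_trans ?_ hS) hν_sum⟩
  rw [sum_cubeW, Finset.sum_mul]
  refine Finset.sum_le_sum fun f _ => ?_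
  have hD : dE a (fun i => ((f i : ℕ) : ℝ)) ^ 2 = ∑ i, X i (f i) :=
    Real.sq_sqrt (Finset.sum_nonneg fun i _ => hX0 i (f i))
  have hm := Real.sq_sqrt hν_sum.le
  have hD0 : 0 ≤ dE a (fun i => ((f i : ℕ) : ℝ)) := Real.sqrt_nonneg _
  have hm0 := Real.sqrt_nonneg (∑ i, ν i)
  rw [Finset.sum_sub_distrib, ← hD]
  generalize dE a (fun i => ((f i : ℕ) : ℝ)) = D at *
  generalize √(∑ i, ν i) = m at *
  rw [← hm, sq_sub_sq, mul_pow, mul_comm]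
  gcongr
  linarith

/-- Normalized distances from `a` have total squared difference at most `4 M ^ 2 / d` over the
pairs of lattice points, `M` being the number of lattice points. -/
theorem sum_dn_sub_sq_le {d N : ℕ} (hd : 1 ≤ d) (hN : 1 ≤ N) {a : Fin d → ℝ}
    (ha : a ∈ cubeW d N) :
    ∑ p ∈ cubeW d N ×ˢ cubeW d N, (dn d N a p.1 - dn d N a p.2) ^ 2 ≤
      4 * (((N : ℝ) + 1) ^ d) ^ 2 / d := by
  obtain ⟨m, hm⟩ := exists_sum_dE_sub_sq_le hd hN ha
  have hd0 : (0 : ℝ) < d := by exact_mod_cast hd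
  have hN0 : (0 : ℝ) < N := by exact_mod_cast hN
  have hc : ((cubeW d N).card : ℝ) = ((N : ℝ) + 1) ^ d := by simp [card_cubeW]
  have hpt (x y : ℝ) : (x / (√d * N) - y / (√d * N)) ^ 2 ≤
      (2 * (x - m) ^ 2 + 2 * (y - m) ^ 2) / (d * (N : ℝ) ^ 2) := by
    rw [← sub_div, div_pow, mul_pow, Real.sq_sqrt hd0.le]
    gcongr
    nlinarith [sq_nonneg (x - m + (y - m))]
  calc _ ≤ ∑ p ∈ cubeW d N ×ˢ cubeW d N,
        (2 * (dE a p.1 - m) ^ 2 + 2 * (dE a p.2 - m) ^ 2) / (d * (N : ℝ) ^ 2) :=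
        Finset.sum_le_sum fun p _ => hpt _ _
    _ = 4 * ((N : ℝ) + 1) ^ d * (∑ w ∈ cubeW d N, (dE a w - m) ^ 2) / (d * (N : ℝ) ^ 2) := by
        rw [← Finset.sum_div, Finset.sum_product]
        simp only [Finset.sum_add_distrib, Finset.sum_const, ← Finset.mul_sum, nsmul_eq_mul, hc]
        ring
    _ ≤ 4 * ((N : ℝ) + 1) ^ d * (((N : ℝ) + 1) ^ d * (N : ℝ) ^ 2) / (d * (N : ℝ) ^ 2) := by
        gcongr
    _ = _ := by field_simp

theorem card_TaW {d N : ℕ} {a : Fin d → ℝ} (ha : a ∈ cubeW d N) :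
    ((TaW d N a).card : ℝ) = (((N : ℝ) + 1) ^ d - 1) * (((N : ℝ) + 1) ^ d - 2) := by
  classical
  have h : TaW d N a = ((cubeW d N).erase a).offDiag := by
    ext p
    simp only [TaW, Finset.mem_filter, Finset.mem_product, Finset.mem_offDiag, Finset.mem_erase]
    grind
  rw [h, Finset.offDiag_card, Nat.cast_sub (Nat.le_mul_self _), Nat.cast_mul,
    Finset.cast_card_erase_of_mem ha, card_cubeW]
  push_cast
  ring

theorem stmt12 (η : ℝ) (hη : η ∈ Set.Ioo (0 : ℝ) (1 / 2)) (d N : ℕ) (hd : 2 ≤ d) (hN : 1 ≤ N)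
    (a : Fin d → ℝ) (ha : a ∈ cubeW d N) :
    (1 : ℝ) - (102 / 15) * (1 / (d : ℝ) ^ ((1 : ℝ) - 2 * η)) ≤
      (pcount (TaW d N a)
          (fun p => |dn d N a p.1 - dn d N a p.2| ≤ 2 / (d : ℝ) ^ η) : ℝ) /
        (TaW d N a).card := by
  classical
  have hd0 : (0 : ℝ) < d := by positivity
  set M : ℝ := ((N : ℝ) + 1) ^ d with hM_def
  set r : ℝ := (d : ℝ) ^ η with hr_def
  have hr : 0 < r := Real.rpow_pos_of_pos hd0 η
  have hM : 4 ≤ M := by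
    have hN1 : (2 : ℝ) ≤ (N : ℝ) + 1 := by
      have : (1 : ℝ) ≤ N := by exact_mod_cast hN
      linarith
    calc (4 : ℝ) = 2 ^ 2 := by norm_num
      _ ≤ ((N : ℝ) + 1) ^ 2 := by gcongr
      _ ≤ M := pow_le_pow_right₀ (by linarith) hd
  have hT := card_TaW ha
  rw [← hM_def] at hT
  have hpow : (d : ℝ) ^ ((1 : ℝ) - 2 * η) = d / r ^ 2 := by
    rw [Real.rpow_sub hd0, Real.rpow_one, mul_comm, Real.rpow_mul hd0.le]
    norm_cast
  set P : (Fin d → ℝ) × (Fin d → ℝ) → Prop :=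
    fun p => |dn d N a p.1 - dn d N a p.2| ≤ 2 / r with hP
  have hsplit : (pcount (TaW d N a) P : ℝ) + ((TaW d N a).filter fun p => ¬ P p).card =
      (TaW d N a).card := by
    rw [pcount]
    exact_mod_cast Finset.card_filter_add_card_filter_not (s := TaW d N a) P
  set B := (TaW d N a).filter fun p => ¬ P p with hB
  have hmarkov : (B.card : ℝ) * (2 / r) ^ 2 ≤ 4 * M ^ 2 / d := by
    refine le_trans ?_ (sum_dn_sub_sq_le (by omega) hN ha)
    rw [← nsmul_eq_mul]
    refine (Finset.card_nsmul_le_sum B _ _ fun p hp => ?_).trans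
      (Finset.sum_le_sum_of_subset_of_nonneg
        ((Finset.filter_subset _ _).trans (Finset.filter_subset _ _)) fun p _ _ => sq_nonneg _)
    have h : 2 / r < |dn d N a p.1 - dn d N a p.2| := not_le.1 (Finset.mem_filter.1 hp).2
    rw [← sq_abs (dn d N a p.1 - dn d N a p.2)]
    gcongr
  have hbad : (B.card : ℝ) ≤ M ^ 2 * (r ^ 2 / d) := by
    have : 0 < 4 / r ^ 2 := by positivity
    refine le_of_mul_le_mul_right (le_of_eq_of_le ?_ (hmarkov.trans_eq ?_)) this
    · ring
    · field_simp
  have hMT : M ^ 2 ≤ 102 / 15 * (TaW d N a).card := by rw [hT]; nlinarith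
  have hTpos : (0 : ℝ) < (TaW d N a).card := by
    rw [hT]; exact mul_pos (by linarith) (by linarith)
  rw [le_div_iff₀ hTpos, hpow, one_div_div]
  have := hbad.trans (mul_le_mul_of_nonneg_right hMT (by positivity : 0 ≤ r ^ 2 / (d : ℝ)))
  linarith
end
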